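/- arXiv:2211.08729 — 2 statements merged into one kernel-verified Lean document; each statement's English description precedes it below -/
import Mathlib

section
/- There exist integers γ₁, γ₂ ≥ 1, depending only on N, such that for every prime p, every binary form f of degree N over ℤ_p with nonzero discriminant, and every integer e ≥ 0, the number of G_N(ℤ_p)-orbits on the set {(A,B) ∈ W_N^0(ℤ_p) : inv(A,B) = f and ν_p(λ(A,B)) = e} is at most p^{e·γ₁·n^{γ₂}}; in particular this set of orbits is finite. -/
open Matrix MvPolynomial

/-- Pairs of `N × N` matrices over `R`, with `N = 2n+1`. -/
abbrev MPair (n : ℕ) (R : Type*) : Type _ :=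
  Matrix (Fin (2*n+1)) (Fin (2*n+1)) R × Matrix (Fin (2*n+1)) (Fin (2*n+1)) R

/-- The action of a matrix `g` on a pair: `g • (A, B) = (g A gᵀ, g B gᵀ)`. -/
def actPair {R : Type*} [CommRing R] {m : ℕ} (g : Matrix (Fin m) (Fin m) R)
    (w : Matrix (Fin m) (Fin m) R × Matrix (Fin m) (Fin m) R) :
    Matrix (Fin m) (Fin m) R × Matrix (Fin m) (Fin m) R :=
  (g * w.1 * g.transpose, g * w.2 * g.transpose)

/-- Membership in `W_N(R)`: both matrices are symmetric. -/
def WNmem {R : Type*} [CommRing R] (n : ℕ) (w : MPair n R) : Prop := w.1.IsSymm ∧ w.2.IsSymm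

/-- The inclusion `Fin n → Fin (2n+1)` of the first `n` indices. -/
def rowIdx (n : ℕ) (i : Fin n) : Fin (2*n+1) := Fin.castLE (by omega) i

/-- The inclusion `Fin (n+1) → Fin (2n+1)` of the last `n+1` indices. -/
def colIdx (n : ℕ) (j : Fin (n+1)) : Fin (2*n+1) :=
  Fin.cast (by omega) (Fin.natAdd n j)

/-- The coefficient of `x^{N-i} y^i` in a binary `N`-ic form (written in
`MvPolynomial (Fin 2) R`, where variable `0` is `x` and variable `1` is `y`). -/
noncomputable def formCoeff {R : Type*} [CommRing R] (f : MvPolynomial (Fin 2) R) (N i : ℕ) : R :=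
  MvPolynomial.coeff (Finsupp.single (0 : Fin 2) (N - i) + Finsupp.single (1 : Fin 2) i) f

/-- The `λ`-invariant of a pair `(A,B)`, computed from the top-right `n × (n+1)` blocks:
the determinant of the `(n+1) × (n+1)` matrix whose `(i,j)` entry (0-indexed) is `(-1)^i`
times the coefficient of `x^{n-j} y^j` in `det(x A^{(i)} - y B^{(i)})`, where `A^{(i)}`,
`B^{(i)}` are obtained from the top-right `n × (n+1)` blocks by deleting the `i`-th column. -/
noncomputable def lambdaInv {R : Type*} [CommRing R] (n : ℕ) (w : MPair n R) : R :=
  Matrix.det (Matrix.of fun i j : Fin (n+1) =>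
    (-1 : R) ^ (i : ℕ) *
      formCoeff
        (Matrix.det (Matrix.of fun r c : Fin n =>
          MvPolynomial.X 0 * MvPolynomial.C (w.1 (rowIdx n r) (colIdx n (i.succAbove c))) -
          MvPolynomial.X 1 * MvPolynomial.C (w.2 (rowIdx n r) (colIdx n (i.succAbove c)))))
        n (j : ℕ))
/-- Membership in `W_N^0(R)`: symmetric pairs vanishing on the top-left `n × n` block. -/
def W0mem {R : Type*} [CommRing R] (n : ℕ) (w : MPair n R) : Prop :=
  WNmem n w ∧ ∀ i j : Fin (2*n+1), (i : ℕ) < n → (j : ℕ) < n → w.1 i j = 0 ∧ w.2 i j = 0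

/-- Membership in `G_N(R) ⊆ SL_N(R)`: determinant one and vanishing top-right `n × (n+1)`
block (1-indexed: `g_{ij} = 0` whenever `i ≤ n` and `j ≥ n+1`). -/
def GNmem {R : Type*} [CommRing R] (n : ℕ) (g : Matrix (Fin (2*n+1)) (Fin (2*n+1)) R) : Prop :=
  g.det = 1 ∧ ∀ i j : Fin (2*n+1), (i : ℕ) < n → n ≤ (j : ℕ) → g i j = 0

/-- `inv(A,B) = (-1)^n det(x A - y B)`, a binary `N`-ic form realized in
`MvPolynomial (Fin 2) R` (variable `0` is `x`, variable `1` is `y`). -/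
noncomputable def invForm {R : Type*} [CommRing R] (n : ℕ) (w : MPair n R) :
    MvPolynomial (Fin 2) R :=
  (-1) ^ n *
    Matrix.det (Matrix.of fun i j : Fin (2*n+1) =>
      MvPolynomial.X 0 * MvPolynomial.C (w.1 i j) - MvPolynomial.X 1 * MvPolynomial.C (w.2 i j))

/-- `x ∈ ℤ_p` has `p`-adic valuation exactly `a`. -/
def pvalEq {p : ℕ} [Fact p.Prime] (x : ℤ_[p]) (a : ℕ) : Prop :=
  (p : ℤ_[p]) ^ a ∣ x ∧ ¬ (p : ℤ_[p]) ^ (a + 1) ∣ x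

/-- The type of `G_N(ℤ_p)`-orbits on the set of `(A,B) ∈ W_N^0(ℤ_p)` with
`inv(A,B) = f` and `ν_p(λ(A,B)) = e`. -/
def GNorbits (n p : ℕ) [Fact p.Prime] (f : MvPolynomial (Fin 2) ℤ_[p]) (e : ℕ) : Type _ :=
  Quot fun w w' : {w : MPair n ℤ_[p] //
      W0mem n w ∧ invForm n w = f ∧ pvalEq (lambdaInv n w) e} =>
    ∃ g : Matrix (Fin (2*n+1)) (Fin (2*n+1)) ℤ_[p],
      GNmem n g ∧ actPair g (w : MPair n ℤ_[p]) = (w' : MPair n ℤ_[p])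

section Minors

variable {R S : Type*} [CommRing R] [CommRing S] {n : ℕ}

/-- A matrix over `R`, viewed as a matrix of constant polynomials. -/
noncomputable abbrev constMatrix {m k : Type*} (Q : Matrix m k R) :
    Matrix m k (MvPolynomial (Fin 2) R) :=
  Q.map C

/-- The matrix of linear forms `x A - y B`. -/
noncomputable def pencil {m k : Type*} (A B : Matrix m k R) : Matrix m k (MvPolynomial (Fin 2) R) :=
  Matrix.of fun i j => X 0 * C (A i j) - X 1 * C (B i j)

theorem pencil_apply {m k : Type*} (A B : Matrix m k R) (i : m) (j : k) :
    pencil A B i j = X 0 * C (A i j) - X 1 * C (B i j) := rfl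

theorem pencil_mul {m k l : Type*} [Fintype k] (A B : Matrix m k R) (Q : Matrix k l R) :
    pencil A B * constMatrix Q = pencil (A * Q) (B * Q) := by
  ext1 i j
  rw [Matrix.mul_apply, pencil_apply, Matrix.mul_apply, Matrix.mul_apply, map_sum, map_sum,
    Finset.mul_sum, Finset.mul_sum, ← Finset.sum_sub_distrib]
  simp only [Matrix.map_apply, map_mul, pencil_apply]
  exact Finset.sum_congr rfl fun _ _ => by ring

theorem mul_pencil {m k l : Type*} [Fintype k] (Q : Matrix l k R) (A B : Matrix k m R) :
    constMatrix Q * pencil A B = pencil (Q * A) (Q * B) := by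
  ext1 i j
  rw [Matrix.mul_apply, pencil_apply, Matrix.mul_apply, Matrix.mul_apply, map_sum, map_sum,
    Finset.mul_sum, Finset.mul_sum, ← Finset.sum_sub_distrib]
  simp only [Matrix.map_apply, map_mul, pencil_apply]
  exact Finset.sum_congr rfl fun _ _ => by ring

theorem pencil_sub {m k : Type*} (A B A' B' : Matrix m k R) :
    pencil (A - A') (B - B') = pencil A B - pencil A' B' := by
  ext1 i j
  simp only [pencil, Matrix.of_apply, Matrix.sub_apply, map_sub]
  ring

theorem pencil_smul {m k : Type*} (c : R) (A B : Matrix m k R) :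
    pencil (c • A) (c • B) = (C c : MvPolynomial (Fin 2) R) • pencil A B := by
  ext1 i j
  simp only [pencil, Matrix.of_apply, Matrix.smul_apply, map_mul, smul_eq_mul]
  ring

/-- The vector of signed maximal minors of an `n × (n+1)` matrix. -/
def minorVec (M : Matrix (Fin n) (Fin (n+1)) R) : Fin (n+1) → R :=
  fun i => (-1) ^ (i : ℕ) * (M.submatrix id i.succAbove).det

theorem det_cons_row (a : Fin (n+1) → R) (M : Matrix (Fin n) (Fin (n+1)) R) :
    (Matrix.of (Fin.cons a M : Fin (n+1) → Fin (n+1) → R)).det = a ⬝ᵥ minorVec M := by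
  rw [Matrix.det_succ_row_zero, dotProduct]
  refine Finset.sum_congr rfl fun i _ => ?_
  change (-1) ^ (i : ℕ) * a i * (M.submatrix id i.succAbove).det = a i * minorVec M i
  rw [minorVec]
  ring

theorem mulVec_minorVec (M : Matrix (Fin n) (Fin (n+1)) R) : M *ᵥ minorVec M = 0 := by
  ext i
  rw [Matrix.mulVec, ← det_cons_row, Pi.zero_apply]
  exact Matrix.det_zero_of_row_eq (Fin.succ_ne_zero i).symm rfl

theorem mulVec_minorVec_mul (M : Matrix (Fin n) (Fin (n+1)) R)
    (Q : Matrix (Fin (n+1)) (Fin (n+1)) R) :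
    Q *ᵥ minorVec (M * Q) = Q.det • minorVec M := by
  have key (a : Fin (n+1) → R) :
      (a ᵥ* Q) ⬝ᵥ minorVec (M * Q) = a ⬝ᵥ (Q.det • minorVec M) := by
    rw [dotProduct_smul, ← det_cons_row, ← det_cons_row, smul_eq_mul, mul_comm Q.det,
      ← Matrix.det_mul]
    congr 1
    ext i j
    refine Fin.cases ?_ (fun i => ?_) i <;> rfl
  ext i
  have := key (Pi.single i 1)
  rwa [← dotProduct_mulVec, single_one_dotProduct, single_one_dotProduct] at this

theorem minorVec_mul (H : Matrix (Fin n) (Fin n) R) (M : Matrix (Fin n) (Fin (n+1)) R) :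
    minorVec (H * M) = H.det • minorVec M := by
  ext i
  have : (H * M).submatrix id i.succAbove = H * M.submatrix id i.succAbove := rfl
  rw [minorVec, this, Matrix.det_mul, Pi.smul_apply, minorVec, smul_eq_mul]
  ring

/-- The coefficients of the signed maximal minors of `x A - y B`, as forms of degree `n`. -/
noncomputable def minorCoeff (A B : Matrix (Fin n) (Fin (n+1)) R) :
    Matrix (Fin (n+1)) (Fin (n+1)) R :=
  Matrix.of fun i j =>
    (-1) ^ (i : ℕ) * formCoeff ((pencil A B).submatrix id i.succAbove).det n j

theorem minorCoeff_map (φ : R →+* S) (A B : Matrix (Fin n) (Fin (n+1)) R) :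
    minorCoeff (A.map φ) (B.map φ) = (minorCoeff A B).map φ := by
  ext i j
  have : (pencil (A.map φ) (B.map φ)).submatrix id i.succAbove =
      (MvPolynomial.map φ).mapMatrix ((pencil A B).submatrix id i.succAbove) := by
    ext1 r c
    simp [pencil]
  simp only [minorCoeff, Matrix.of_apply, Matrix.map_apply, this, ← RingHom.map_det, formCoeff,
    MvPolynomial.coeff_map, map_mul, map_pow, map_neg, map_one]

/-- The vector of monomials of degree `n` in two variables. -/
noncomputable def monomialVec (R : Type*) [CommRing R] (n : ℕ) :
    Fin (n+1) → MvPolynomial (Fin 2) R :=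
  fun j => X 0 ^ (n - (j : ℕ)) * X 1 ^ (j : ℕ)

theorem isHomogeneous_det_pencil {m : Type*} [Fintype m] [DecidableEq m] (A B : Matrix m m R) :
    (pencil A B).det.IsHomogeneous (Fintype.card m) := by
  rw [Matrix.det_apply]
  refine IsHomogeneous.sum _ _ _ fun σ _ => ?_
  have h : (∏ i, pencil A B (σ i) i).IsHomogeneous (∑ _i : m, 1) := by
    refine IsHomogeneous.prod _ _ _ fun i _ => ?_
    refine IsHomogeneous.sub ?_ ?_
    · exact (isHomogeneous_X R 0).mul (isHomogeneous_C _ _)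
    · exact (isHomogeneous_X R 1).mul (isHomogeneous_C _ _)
  rw [Finset.sum_const, Finset.card_univ, smul_eq_mul, mul_one] at h
  rcases Int.units_eq_one_or (Equiv.Perm.sign σ) with hs | hs
  · simpa [hs] using h
  · simpa [hs] using h.neg

theorem eq_sum_formCoeff {f : MvPolynomial (Fin 2) R} (hf : f.IsHomogeneous n) :
    f = ∑ j : Fin (n+1), C (formCoeff f n j) * monomialVec R n j := by
  have hmon (j : Fin (n+1)) : monomialVec R n j =
      monomial (Finsupp.single (0 : Fin 2) (n - (j : ℕ)) + Finsupp.single (1 : Fin 2) (j : ℕ)) 1 := by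
    rw [monomialVec, X_pow_eq_monomial, X_pow_eq_monomial, monomial_mul, one_mul]
  ext m
  simp only [coeff_sum, coeff_C_mul, hmon, coeff_monomial, mul_ite, mul_one, mul_zero]
  by_cases hm : m 0 + m 1 = n
  · have hm' : Finsupp.single (0 : Fin 2) (n - m 1) + Finsupp.single (1 : Fin 2) (m 1) = m := by
      ext i
      fin_cases i <;> simp
      omega
    rw [Finset.sum_eq_single ⟨m 1, by omega⟩]
    · simp only [formCoeff, hm', if_true]
    · intro j _ hj
      refine if_neg fun h => hj ?_
      ext
      simp [← h]
    · simp
  · rw [Finset.sum_eq_zero]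
    · by_contra h
      have := hf h
      rw [Finsupp.weight_apply, Finsupp.sum_fintype _ _ (by simp)] at this
      simp at this
      exact hm this
    · intro j _
      refine if_neg fun h => hm ?_
      simp [← h]
      omega

theorem minorVec_pencil (A B : Matrix (Fin n) (Fin (n+1)) R) :
    minorVec (pencil A B) = constMatrix (minorCoeff A B) *ᵥ monomialVec R n := by
  ext1 i
  have h := isHomogeneous_det_pencil (A.submatrix id i.succAbove) (B.submatrix id i.succAbove)
  rw [Fintype.card_fin] at h
  change (-1) ^ (i : ℕ) * (pencil (A.submatrix id i.succAbove) (B.submatrix id i.succAbove)).det = _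
  rw [eq_sum_formCoeff h, Finset.mul_sum, Matrix.mulVec, dotProduct]
  refine Finset.sum_congr rfl fun j _ => ?_
  simp only [minorCoeff, Matrix.map_apply, Matrix.of_apply, map_mul, map_pow, map_neg, map_one,
    mul_assoc]
  rfl

end Minors

section Syzygies

variable {R : Type*} [CommRing R] {n : ℕ}

/-- The matrix whose pencil with `shiftB` has the consecutive monomials as minors: the `x`-part. -/
def shiftA (R : Type*) [CommRing R] (n : ℕ) : Matrix (Fin n) (Fin (n+1)) R :=
  Matrix.of fun i j => if j = i.succ then 1 else 0

/-- The `y`-part of the standard pencil, see `shiftA`. -/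
def shiftB (R : Type*) [CommRing R] (n : ℕ) : Matrix (Fin n) (Fin (n+1)) R :=
  Matrix.of fun i j => if j = i.castSucc then 1 else 0

theorem mul_shiftA_zero {m : Type*} (U : Matrix m (Fin n) R) (r : m) :
    (U * shiftA R n) r 0 = 0 := by
  rw [Matrix.mul_apply]
  exact Finset.sum_eq_zero fun i _ => by simp [shiftA, (Fin.succ_ne_zero i).symm]

theorem mul_shiftA_succ {m : Type*} (U : Matrix m (Fin n) R) (r : m) (i : Fin n) :
    (U * shiftA R n) r i.succ = U r i := by
  simp [Matrix.mul_apply, shiftA, Fin.succ_inj]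

theorem mul_shiftB_castSucc {m : Type*} (U : Matrix m (Fin n) R) (r : m) (i : Fin n) :
    (U * shiftB R n) r i.castSucc = U r i := by
  simp [Matrix.mul_apply, shiftB, Fin.castSucc_inj]

theorem mul_shiftB_last {m : Type*} (U : Matrix m (Fin n) R) (r : m) :
    (U * shiftB R n) r (Fin.last n) = 0 := by
  rw [Matrix.mul_apply]
  exact Finset.sum_eq_zero fun i _ => by simp [shiftB, (Fin.castSucc_lt_last i).ne']

/-- Setting `x = 1` and `y = X`. -/
noncomputable def dehom (R : Type*) [CommRing R] : MvPolynomial (Fin 2) R →+* Polynomial R :=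
  (MvPolynomial.aeval ![1, Polynomial.X] : MvPolynomial (Fin 2) R →ₐ[R] Polynomial R).toRingHom

theorem dehom_monomialVec (j : Fin (n+1)) :
    dehom R (monomialVec R n j) = Polynomial.X ^ (j : ℕ) := by
  simp [dehom, monomialVec]

theorem dehom_pencil {m k : Type*} (A B : Matrix m k R) (i : m) (j : k) :
    dehom R (pencil A B i j) = Polynomial.C (A i j) - Polynomial.X * Polynomial.C (B i j) := by
  simp [dehom, pencil]

/-- Linear syzygies of the monomials of degree `n` are combinations of the standard ones. -/
theorem eq_mul_shift_of_mulVec_eq_zero {m : Type*} (A B : Matrix m (Fin (n+1)) R)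
    (h : pencil A B *ᵥ monomialVec R n = 0) :
    A = B.submatrix id Fin.castSucc * shiftA R n ∧
      B = B.submatrix id Fin.castSucc * shiftB R n := by
  have coeff_sum (a : Fin (n+1) → R) (j : Fin (n+1)) :
      (∑ i, Polynomial.C (a i) * Polynomial.X ^ (i : ℕ)).coeff j = a j := by
    simp [Polynomial.coeff_C_mul, Polynomial.coeff_X_pow,
      Fin.val_inj]
  have coeff_sum_last (a : Fin (n+1) → R) :
      (∑ i, Polynomial.C (a i) * Polynomial.X ^ (i : ℕ)).coeff (n+1) = 0 := by
    simp only [Polynomial.finsetSum_coeff, Polynomial.coeff_C_mul, Polynomial.coeff_X_pow]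
    exact Finset.sum_eq_zero fun i _ => by rw [if_neg (by omega), mul_zero]
  have key (r : m) : ∑ i, Polynomial.C (A r i) * Polynomial.X ^ (i : ℕ) =
      Polynomial.X * ∑ i, Polynomial.C (B r i) * Polynomial.X ^ (i : ℕ) := by
    have := congrArg (dehom R) (congrFun h r)
    simp only [Matrix.mulVec, dotProduct, map_sum, map_mul, dehom_monomialVec, dehom_pencil,
      Pi.zero_apply, map_zero] at this
    rw [← sub_eq_zero, Finset.mul_sum, ← Finset.sum_sub_distrib, ← this]
    exact Finset.sum_congr rfl fun i _ => by ring
  constructor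
  · ext r j
    refine Fin.cases ?_ (fun i => ?_) j
    · rw [mul_shiftA_zero, ← coeff_sum (A r) 0, key r]
      simp
    · rw [mul_shiftA_succ, ← coeff_sum (A r) i.succ, key r, Fin.val_succ, Polynomial.coeff_X_mul]
      exact coeff_sum (B r) i.castSucc
  · ext r j
    refine Fin.lastCases ?_ (fun i => ?_) j
    · rw [mul_shiftB_last, ← coeff_sum (B r) (Fin.last n), Fin.val_last,
        ← Polynomial.coeff_X_mul, ← key r]
      exact coeff_sum_last (A r)
    · rw [mul_shiftB_castSucc]
      rfl

theorem det_pencil_shift :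
    ((pencil (shiftA R n) (shiftB R n)).submatrix id Fin.succ).det = X 0 ^ n := by
  rw [Matrix.det_of_isLowerTriangular]
  · simp [pencil, shiftA, shiftB, Fin.ext_iff]
  · intro i j hij
    have hij' : i < j := hij
    have h1 : j ≠ i := hij'.ne'
    have h2 : j.succ ≠ i.castSucc := by
      simp only [ne_eq, Fin.ext_iff, Fin.val_succ, Fin.val_castSucc]
      omega
    simp [pencil, shiftA, shiftB, h1, h2]

theorem sum_range_add_sum_range_of_reflect {g : ℕ → R} {m a b : ℕ} (hab : a + b = m + 1)
    (hg : ∀ i ≤ m, g (m - i) = g i) :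
    ∑ i ∈ Finset.range a, g i + ∑ i ∈ Finset.range b, g i = ∑ i ∈ Finset.range (m+1), g i := by
  rw [← hab, Finset.sum_range_add]
  congr 1
  rw [← Finset.sum_range_reflect]
  refine Finset.sum_congr rfl fun i hi => ?_
  rw [Finset.mem_range] at hi
  rw [← hg (a + i) (by omega)]
  congr 1
  omega

/-- The coefficients of a symmetric pencil which vanishes on the rational normal curve can be
written as sums of two transposed contributions; `U r t` is the entry at `(r, t - r)`. -/
theorem exists_antidiagonal_split (d₁ d₂ : ℕ → ℕ → R) (h₁ : ∀ i j, d₁ i j = d₁ j i)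
    (h₂ : ∀ i j, d₂ i j = d₂ j i)
    (hz₁ : ∀ i j, n < i → d₁ i j = 0) (hz₂ : ∀ i j, n < i → d₂ i j = 0)
    (h : ∀ s, ∑ i ∈ Finset.range (s+1), d₁ (s-i) i = ∑ i ∈ Finset.range s, d₂ (s-1-i) i) :
    ∃ U : ℕ → ℕ → R, (∀ r c, U r (r+c) + U c (r+c) = d₂ r c) ∧
      (∀ t r c, r + c = t + 1 → U r t + U c t = d₁ r c) ∧
      (∀ t, U (t+1) t = 0) ∧ ∀ r, U r (r+n) = 0 := by
  have refl₁ (s i : ℕ) (hi : i ≤ s) : d₁ (s-(s-i)) (s-i) = d₁ (s-i) i := by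
    rw [h₁, Nat.sub_sub_self hi]
  have refl₂ (s i : ℕ) (hi : i ≤ s) : d₂ (s-(s-i)) (s-i) = d₂ (s-i) i := by
    rw [h₂, Nat.sub_sub_self hi]
  refine ⟨fun r t => ∑ i ∈ Finset.range (r+1), d₁ (t+1-i) i - ∑ i ∈ Finset.range r, d₂ (t-i) i,
    fun r c => ?_, fun t r c hrc => ?_, fun t => ?_, fun r => ?_⟩
  · have e₁ := sum_range_add_sum_range_of_reflect (g := fun i => d₁ (r+c+1-i) i) (m := r+c+1)
      (a := r+1) (b := c+1) (by omega) (refl₁ _)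
    have e₂ := sum_range_add_sum_range_of_reflect (g := fun i => d₂ (r+c-i) i) (m := r+c)
      (a := r+1) (b := c) (by omega) (refl₂ _)
    rw [Finset.sum_range_succ _ r, Nat.add_sub_cancel_left, h₂ c r] at e₂
    have := h (r+c+1)
    rw [Nat.add_sub_cancel] at this
    linear_combination e₁ - e₂ + this
  · have e₁ := sum_range_add_sum_range_of_reflect (g := fun i => d₁ (t+1-i) i) (m := t+1)
      (a := r) (b := c+1) (by omega) (refl₁ _)
    have e₂ := sum_range_add_sum_range_of_reflect (g := fun i => d₂ (t-i) i) (m := t)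
      (a := r) (b := c) (by omega) (refl₂ _)
    have := h (t+1)
    rw [Nat.add_sub_cancel] at this
    have hd : d₁ (t+1-r) r = d₁ r c := by
      rw [h₁, ← hrc, Nat.add_sub_cancel_left]
    beta_reduce
    rw [Finset.sum_range_succ _ r]
    linear_combination e₁ - e₂ + this + hd
  · have := h (t+1)
    rw [Nat.add_sub_cancel] at this
    exact sub_eq_zero.mpr this
  · beta_reduce
    rw [Finset.sum_eq_zero, Finset.sum_eq_zero, sub_zero]
    · intro i hi
      rw [Finset.mem_range] at hi
      exact hz₂ _ _ (by omega)
    · intro i hi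
      rw [Finset.mem_range] at hi
      exact hz₁ _ _ (by omega)

/-- Extension of a matrix by zero to all pairs of natural numbers. -/
def extendZero (D : Matrix (Fin (n+1)) (Fin (n+1)) R) (i j : ℕ) : R :=
  if h : i < n + 1 ∧ j < n + 1 then D ⟨i, h.1⟩ ⟨j, h.2⟩ else 0

theorem extendZero_val (D : Matrix (Fin (n+1)) (Fin (n+1)) R) (i j : Fin (n+1)) :
    extendZero D i j = D i j :=
  dif_pos ⟨i.2, j.2⟩

theorem extendZero_of_lt (D : Matrix (Fin (n+1)) (Fin (n+1)) R) {i j : ℕ} (hi : n < i) :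
    extendZero D i j = 0 :=
  dif_neg fun h => by omega

theorem extendZero_comm {D : Matrix (Fin (n+1)) (Fin (n+1)) R} (hD : D.IsSymm) (i j : ℕ) :
    extendZero D i j = extendZero D j i := by
  unfold extendZero
  split_ifs with h h' h'
  · exact hD.apply _ _
  · exact absurd h.symm h'
  · exact absurd h'.symm h
  · rfl

theorem coeff_sum_monomials (D : Matrix (Fin (n+1)) (Fin (n+1)) R) (s : ℕ) :
    (∑ i, ∑ j, Polynomial.C (D i j) * Polynomial.X ^ ((i : ℕ) + (j : ℕ))).coeff s =
      ∑ i ∈ Finset.range (s+1), extendZero D (s-i) i := by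
  have h1 : ∑ i ∈ Finset.range (s+1), extendZero D (s-i) i =
      ∑ p ∈ Finset.HasAntidiagonal.antidiagonal s, extendZero D p.2 p.1 :=
    (Finset.Nat.sum_antidiagonal_eq_sum_range_succ (fun i j => extendZero D j i) s).symm
  rw [h1]
  simp only [Polynomial.finsetSum_coeff, Polynomial.coeff_C_mul, Polynomial.coeff_X_pow,
    mul_ite, mul_one, mul_zero]
  rw [← Fintype.sum_prod_type' fun i j : Fin (n+1) => if s = (i : ℕ) + (j : ℕ) then D i j else 0,
    ← Finset.sum_filter]
  refine Finset.sum_of_injOn (fun q => ((q.2 : ℕ), (q.1 : ℕ))) ?_ ?_ ?_ ?_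
  · rintro ⟨i, j⟩ _ ⟨i', j'⟩ _ h
    simp only [Prod.mk.injEq] at h
    exact Prod.ext (Fin.ext h.2) (Fin.ext h.1)
  · rintro ⟨i, j⟩ h
    simp at h ⊢
    omega
  · rintro ⟨a, b⟩ hab h
    refine dif_neg fun hlt => h ?_
    refine ⟨(⟨b, hlt.1⟩, ⟨a, hlt.2⟩), ?_, rfl⟩
    simp at hab ⊢
    omega
  · rintro ⟨i, j⟩ _
    exact (extendZero_val D i j).symm

/-- A symmetric pencil which vanishes on the rational normal curve is a symmetrized multiple of
the standard pencil. -/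
theorem exists_eq_mul_shift_add_transpose {D₁ D₂ : Matrix (Fin (n+1)) (Fin (n+1)) R}
    (h₁ : D₁.IsSymm) (h₂ : D₂.IsSymm)
    (h : monomialVec R n ⬝ᵥ (pencil D₁ D₂ *ᵥ monomialVec R n) = 0) :
    ∃ U : Matrix (Fin (n+1)) (Fin n) R,
      D₁ = U * shiftA R n + (U * shiftA R n)ᵀ ∧ D₂ = U * shiftB R n + (U * shiftB R n)ᵀ := by
  have hpoly : ∑ i, ∑ j, Polynomial.C (D₁ i j) * Polynomial.X ^ ((i : ℕ) + (j : ℕ)) =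
      Polynomial.X * ∑ i, ∑ j, Polynomial.C (D₂ i j) * Polynomial.X ^ ((i : ℕ) + (j : ℕ)) := by
    have := congrArg (dehom R) h
    simp only [Matrix.mulVec, dotProduct, map_sum, map_mul, dehom_monomialVec, dehom_pencil,
      map_zero, Finset.mul_sum] at this
    rw [← sub_eq_zero, Finset.mul_sum, ← Finset.sum_sub_distrib, ← this]
    refine Finset.sum_congr rfl fun i _ => ?_
    rw [Finset.mul_sum, ← Finset.sum_sub_distrib]
    exact Finset.sum_congr rfl fun j _ => by ring
  have hsum (s : ℕ) : ∑ i ∈ Finset.range (s+1), extendZero D₁ (s-i) i =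
      ∑ i ∈ Finset.range s, extendZero D₂ (s-1-i) i := by
    rw [← coeff_sum_monomials, hpoly]
    cases s with
    | zero => simp
    | succ s => rw [Polynomial.coeff_X_mul, coeff_sum_monomials, Nat.add_sub_cancel]
  obtain ⟨U, hU₂, hU₁, hU0, hUn⟩ := exists_antidiagonal_split (n := n) _ _
    (extendZero_comm h₁) (extendZero_comm h₂) (fun _ _ => extendZero_of_lt D₁)
    (fun _ _ => extendZero_of_lt D₂) hsum
  have hA (r c : Fin (n+1)) (t : ℕ) (ht : (r : ℕ) + c = t + 1) :
      ((Matrix.of fun (r : Fin (n+1)) (c : Fin n) => U r (r + c)) * shiftA R n) r c = U r t := by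
    revert ht
    refine Fin.cases (fun ht => ?_) (fun i ht => ?_) c
    · rw [mul_shiftA_zero, show (r : ℕ) = t + 1 from ht, hU0]
    · rw [mul_shiftA_succ, Matrix.of_apply, show (r : ℕ) + i = t by rw [Fin.val_succ] at ht; omega]
  have hB (r c : Fin (n+1)) :
      ((Matrix.of fun (r : Fin (n+1)) (c : Fin n) => U r (r + c)) * shiftB R n) r c =
        U r (r + c) := by
    refine Fin.lastCases ?_ (fun i => ?_) c
    · rw [mul_shiftB_last, Fin.val_last, hUn]
    · rw [mul_shiftB_castSucc, Matrix.of_apply, Fin.val_castSucc]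
  refine ⟨Matrix.of fun r c => U r (r + c), ?_, ?_⟩
  · ext r c
    rw [Matrix.add_apply, Matrix.transpose_apply]
    rcases Nat.eq_zero_or_pos ((r : ℕ) + c) with h0 | hpos
    · obtain rfl : r = 0 := Fin.ext (by rw [Fin.val_zero]; omega)
      obtain rfl : c = 0 := Fin.ext (by rw [Fin.val_zero]; omega)
      rw [mul_shiftA_zero, add_zero, ← extendZero_val D₁]
      simpa using hsum 0
    · obtain ⟨t, ht⟩ := Nat.exists_eq_add_of_lt hpos
      rw [hA r c t (by omega), hA c r t (by omega), hU₁ t r c (by omega), extendZero_val]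
  · ext r c
    rw [Matrix.add_apply, Matrix.transpose_apply, hB, hB, add_comm (c : ℕ), hU₂, extendZero_val]

end Syzygies

section Reduction

variable {R : Type*} [CommRing R] {n : ℕ}

theorem exists_eq_add_smul_of_map_mk_eq {m k : Type*} {a : R} {M M' : Matrix m k R}
    (h : M.map (Ideal.Quotient.mk (Ideal.span {a})) =
      M'.map (Ideal.Quotient.mk (Ideal.span {a}))) :
    ∃ Z : Matrix m k R, M' = M + a • Z := by
  have hdvd (i : m) (j : k) : ∃ z, M' i j - M i j = a * z := by
    have := congrFun (congrFun h i) j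
    rw [Matrix.map_apply, Matrix.map_apply, eq_comm, Ideal.Quotient.eq,
      Ideal.mem_span_singleton] at this
    exact this
  choose Z hZ using hdvd
  refine ⟨Matrix.of Z, ?_⟩
  ext i j
  rw [Matrix.add_apply, Matrix.smul_apply, Matrix.of_apply, smul_eq_mul, ← hZ]
  ring

/-- The coefficients of the linear syzygies cut out by `x A - y B` after the change of coordinates
given by its minors. -/
noncomputable def syzygyCoeff (A B : Matrix (Fin n) (Fin (n+1)) R) : Matrix (Fin n) (Fin n) R :=
  (B * minorCoeff A B).submatrix id Fin.castSucc

theorem syzygyCoeff_map {S : Type*} [CommRing S] (φ : R →+* S)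
    (A B : Matrix (Fin n) (Fin (n+1)) R) :
    syzygyCoeff (A.map φ) (B.map φ) = (syzygyCoeff A B).map φ := by
  rw [syzygyCoeff, minorCoeff_map, ← Matrix.map_mul]
  rfl

theorem mul_minorCoeff (A B : Matrix (Fin n) (Fin (n+1)) R) :
    A * minorCoeff A B = syzygyCoeff A B * shiftA R n ∧
      B * minorCoeff A B = syzygyCoeff A B * shiftB R n := by
  refine eq_mul_shift_of_mulVec_eq_zero _ _ ?_
  rw [← pencil_mul, ← Matrix.mulVec_mulVec, ← minorVec_pencil, mulVec_minorVec]

theorem det_constMatrix {m : Type*} [Fintype m] [DecidableEq m] (Q : Matrix m m R) :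
    (constMatrix Q).det = C Q.det :=
  (RingHom.map_det C Q).symm

theorem minorVec_pencil_zero_ne_zero {A B : Matrix (Fin n) (Fin (n+1)) R}
    (h : (minorCoeff A B).det ≠ 0) : ((pencil A B).submatrix id Fin.succ).det ≠ 0 := by
  intro h0
  refine h (Matrix.det_eq_zero_of_row_eq_zero 0 fun j => ?_)
  simp [minorCoeff, h0, formCoeff]

/-- For pairs vanishing on the top-left block, the determinant depends on the bottom-right block
only through its value at the vector of maximal minors. -/
theorem dotProduct_eq_of_det_fromBlocks_eq [IsDomain R] {M : Matrix (Fin n) (Fin (n+1)) R}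
    {S S' : Matrix (Fin (n+1)) (Fin (n+1)) R} (hM : (M.submatrix id Fin.succ).det ≠ 0)
    (h : (Matrix.fromBlocks 0 M Mᵀ S).det = (Matrix.fromBlocks 0 M Mᵀ S').det) :
    minorVec M ⬝ᵥ (S *ᵥ minorVec M) = minorVec M ⬝ᵥ (S' *ᵥ minorVec M) := by
  let E₂ : Matrix (Fin (n+1)) (Fin (n+1)) R := Matrix.of fun i j => if j = 0 then minorVec M i else 0
  let E := Matrix.fromBlocks 0 (shiftA R n) (shiftA R n)ᵀ E₂
  have mul_E₂_zero {m : Type} [Fintype m] (T : Matrix m (Fin (n+1)) R) (i : m) :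
      (T * E₂) i 0 = (T *ᵥ minorVec M) i := by
    simp [Matrix.mul_apply, E₂, Matrix.mulVec, dotProduct]
  have mul_E₂_succ {m : Type} [Fintype m] (T : Matrix m (Fin (n+1)) R) (i : m) (j : Fin n) :
      (T * E₂) i j.succ = 0 := by
    simp [Matrix.mul_apply, E₂]
  have key (T : Matrix (Fin (n+1)) (Fin (n+1)) R) :
      (Matrix.fromBlocks 0 M Mᵀ T).det * E.det =
        (M.submatrix id Fin.succ).det * (minorVec M ⬝ᵥ (T *ᵥ minorVec M)) := by
    have h₁ : M * (shiftA R n)ᵀ = M.submatrix id Fin.succ := by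
      ext i j
      simp [Matrix.mul_apply, shiftA]
    have h₂ : M * E₂ = 0 := by
      ext i j
      refine Fin.cases ?_ (fun j => ?_) j
      · rw [mul_E₂_zero, mulVec_minorVec]
        rfl
      · exact mul_E₂_succ M i j
    have h₃ : (Mᵀ * shiftA R n + T * E₂)ᵀ =
        Matrix.of (Fin.cons (T *ᵥ minorVec M) M : Fin (n+1) → Fin (n+1) → R) := by
      ext j i
      rw [Matrix.transpose_apply, Matrix.add_apply]
      refine Fin.cases ?_ (fun j => ?_) j
      · rw [mul_shiftA_zero, mul_E₂_zero, zero_add]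
        rfl
      · rw [mul_shiftA_succ, mul_E₂_succ, add_zero]
        rfl
    rw [← Matrix.det_mul, Matrix.fromBlocks_multiply, Matrix.zero_mul, Matrix.zero_mul, zero_add,
      zero_add, h₁, h₂, Matrix.det_fromBlocks_zero₁₂, ← Matrix.det_transpose (_ + _), h₃,
      det_cons_row, dotProduct_comm (minorVec M)]
  exact mul_left_cancel₀ hM (by rw [← key, ← key, h])

theorem mul_right_cancel_of_det_ne_zero [IsDomain R] {m k : Type*} [Fintype k] [DecidableEq k]
    {Q : Matrix k k R} (hQ : Q.det ≠ 0) {M N : Matrix m k R} (h : M * Q = N * Q) : M = N := by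
  have := congrArg (· * Q.adjugate) h
  simp only [Matrix.mul_assoc, Matrix.mul_adjugate, Matrix.mul_smul, Matrix.mul_one] at this
  ext i j
  exact mul_left_cancel₀ hQ (congrFun (congrFun this i) j)

theorem conj_cancel_of_det_ne_zero [IsDomain R] {k : Type*} [Fintype k] [DecidableEq k]
    {Q M N : Matrix k k R} (hQ : Q.det ≠ 0) (h : Qᵀ * M * Q = Qᵀ * N * Q) : M = N := by
  have h' := congrArg Matrix.transpose (mul_right_cancel_of_det_ne_zero hQ h)
  rw [Matrix.transpose_mul, Matrix.transpose_mul, Matrix.transpose_transpose] at h'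
  exact Matrix.transpose_injective (mul_right_cancel_of_det_ne_zero hQ h')

theorem det_syzygyCoeff [IsDomain R] {A B : Matrix (Fin n) (Fin (n+1)) R}
    (h : (minorCoeff A B).det ≠ 0) : (syzygyCoeff A B).det = (minorCoeff A B).det := by
  have hC : (constMatrix (minorCoeff A B)).det ≠ 0 := by
    rwa [det_constMatrix, Ne, MvPolynomial.C_eq_zero]
  have h₁ := mulVec_minorVec_mul (pencil A B) (constMatrix (minorCoeff A B))
  rw [pencil_mul, (mul_minorCoeff A B).1, (mul_minorCoeff A B).2, ← mul_pencil, minorVec_mul,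
    minorVec_pencil A B, ← Matrix.mulVec_smul, ← sub_eq_zero, ← Matrix.mulVec_sub] at h₁
  have h₂ := congrFun (Matrix.eq_zero_of_mulVec_eq_zero hC h₁) 0
  have h₃ : minorVec (pencil (shiftA R n) (shiftB R n)) 0 = X 0 ^ n := by
    rw [minorVec, Fin.succAbove_zero, det_pencil_shift]
    simp
  have h₄ : monomialVec R n 0 = X 0 ^ n := by simp [monomialVec]
  rw [Pi.sub_apply, Pi.smul_apply, Pi.smul_apply, Pi.zero_apply, h₃, h₄, sub_eq_zero,
    smul_eq_mul, smul_eq_mul, det_constMatrix, det_constMatrix] at h₂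
  exact MvPolynomial.C_injective _ _ (mul_right_cancel₀ (pow_ne_zero n (X_ne_zero 0)) h₂)

/-- Two matrices congruent modulo `det Q ^ 3`, with determinants agreeing up to a unit, differ by
left multiplication by an invertible matrix congruent to `1` modulo `det Q ^ 2`. -/
theorem exists_mul_eq_of_eq_add_smul [IsDomain R] {k : Type*} [Fintype k] [DecidableEq k]
    {Q Q' Z : Matrix k k R} {μ : R} (hQ : Q.det ≠ 0) (hμ : Q'.det = Q.det * μ)
    (h : Q' = Q + Q.det ^ 3 • Z) :
    ∃ T : Matrix k k R, (1 + Q.det ^ 2 • T) * Q = Q' ∧ (1 + Q.det ^ 2 • T).det = μ := by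
  have hT : (1 + Q.det ^ 2 • (Z * Q.adjugate)) * Q = Q' := by
    rw [h, Matrix.add_mul, Matrix.one_mul, Matrix.smul_mul, Matrix.mul_assoc,
      Matrix.adjugate_mul, Matrix.mul_smul, Matrix.mul_one, smul_smul, ← pow_succ]
  refine ⟨_, hT, mul_left_cancel₀ hQ ?_⟩
  rw [← hμ, ← hT, Matrix.det_mul, mul_comm]

theorem exists_conj_eq_add_smul {k : Type*} [Fintype k] [DecidableEq k] {a : R}
    {S S' Z g gi T : Matrix k k R} (hg : g = 1 + a ^ 2 • T) (hgi : gi * g = 1)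
    (h : S' = S + a ^ 3 • Z) : ∃ D : Matrix k k R, S' = giᵀ * S * gi + a ^ 2 • D := by
  have hgi' : gi = 1 - a ^ 2 • (gi * T) := by
    rw [← hgi, hg, Matrix.mul_add, Matrix.mul_one, Matrix.mul_smul]
    abel
  refine ⟨a • Z + (gi * T)ᵀ * S + S * (gi * T) - a ^ 2 • ((gi * T)ᵀ * S * (gi * T)), ?_⟩
  have : giᵀ * S * gi = (1 - a ^ 2 • (gi * T))ᵀ * S * (1 - a ^ 2 • (gi * T)) := by rw [← hgi']
  rw [h, this]
  simp only [Matrix.transpose_sub, Matrix.transpose_one, Matrix.transpose_smul, Matrix.sub_mul,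
    Matrix.mul_sub, Matrix.one_mul, Matrix.mul_one, Matrix.smul_mul, Matrix.mul_smul, smul_add,
    smul_sub, smul_smul]
  rw [← pow_succ]
  abel

theorem isSymm_of_eq_add_smul [IsDomain R] {k : Type*} {a : R} (ha : a ≠ 0)
    {S S' D : Matrix k k R} (hS : S.IsSymm) (hS' : S'.IsSymm) (h : S' = S + a • D) :
    D.IsSymm := by
  ext i j
  have h₁ := congrFun (congrFun h i) j
  have h₂ := congrFun (congrFun h j) i
  rw [hS'.apply i j, Matrix.add_apply, hS.apply i j, h₁, Matrix.add_apply, add_right_inj] at h₂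
  exact (mul_left_cancel₀ ha h₂).symm

/-- Pairs with the same top-right block and the same invariant, whose bottom-right blocks differ by
a multiple of `λ ^ 2`, differ by a unipotent transformation. -/
theorem exists_unipotent [IsDomain R] {A B : Matrix (Fin n) (Fin (n+1)) R} {a ν : R}
    (ha : (minorCoeff A B).det ≠ 0) (hν : (minorCoeff A B).det * ν = a)
    {S₁ S₂ S₁' S₂' D₁ D₂ : Matrix (Fin (n+1)) (Fin (n+1)) R}
    (hS₁ : S₁' = S₁ + a ^ 2 • D₁) (hS₂ : S₂' = S₂ + a ^ 2 • D₂) (h₁ : D₁.IsSymm) (h₂ : D₂.IsSymm)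
    (ha0 : a ≠ 0)
    (hdet : (Matrix.fromBlocks 0 (pencil A B) (pencil A B)ᵀ (pencil S₁ S₂)).det =
      (Matrix.fromBlocks 0 (pencil A B) (pencil A B)ᵀ (pencil S₁' S₂')).det) :
    ∃ u : Matrix (Fin (n+1)) (Fin n) R,
      S₁' = S₁ + (u * A + (u * A)ᵀ) ∧ S₂' = S₂ + (u * B + (u * B)ᵀ) := by
  set L := minorCoeff A B with hL
  set H := syzygyCoeff A B
  have hq := dotProduct_eq_of_det_fromBlocks_eq (minorVec_pencil_zero_ne_zero ha) hdet
  have hD : pencil S₁' S₂' = pencil S₁ S₂ + (C (a ^ 2) : MvPolynomial (Fin 2) R) • pencil D₁ D₂ := by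
    rw [← pencil_smul, ← sub_eq_iff_eq_add', ← pencil_sub, hS₁, hS₂, add_sub_cancel_left,
      add_sub_cancel_left]
  rw [hD, Matrix.add_mulVec, dotProduct_add, left_eq_add, Matrix.smul_mulVec, dotProduct_smul,
    smul_eq_mul, mul_eq_zero, MvPolynomial.C_eq_zero,
    or_iff_right (pow_ne_zero 2 ha0), minorVec_pencil, ← hL] at hq
  have hq' : monomialVec R n ⬝ᵥ (pencil (Lᵀ * D₁ * L) (Lᵀ * D₂ * L) *ᵥ monomialVec R n) = 0 := by
    rw [← pencil_mul, ← mul_pencil, ← hq, ← Matrix.mulVec_mulVec, ← Matrix.mulVec_mulVec,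
      Matrix.dotProduct_mulVec (monomialVec R n)]
    congr 1
    exact Matrix.vecMul_transpose _ _
  have hsymm {D : Matrix (Fin (n+1)) (Fin (n+1)) R} (h : D.IsSymm) : (Lᵀ * D * L).IsSymm := by
    simp only [Matrix.IsSymm, Matrix.transpose_mul, Matrix.transpose_transpose, h.eq,
      Matrix.mul_assoc]
  obtain ⟨U, hU₁, hU₂⟩ := exists_eq_mul_shift_add_transpose (hsymm h₁) (hsymm h₂) hq'
  have hdetH : H.det = L.det := det_syzygyCoeff ha
  have main {N N₀ : Matrix (Fin n) (Fin (n+1)) R} {S S' D : Matrix (Fin (n+1)) (Fin (n+1)) R}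
      (hN : N * L = H * N₀) (hS : S' = S + a ^ 2 • D)
      (hUD : Lᵀ * D * L = U * N₀ + (U * N₀)ᵀ) :
      S' = S + (ν ^ 2 • (L.adjugateᵀ * U * H.adjugate) * N +
        (ν ^ 2 • (L.adjugateᵀ * U * H.adjugate) * N)ᵀ) := by
    have hW : Lᵀ * (ν ^ 2 • (L.adjugateᵀ * U * H.adjugate) * N) * L = a ^ 2 • (U * N₀) := by
      have e₁ : Lᵀ * L.adjugateᵀ = L.det • (1 : Matrix _ _ R) := by
        rw [← Matrix.transpose_mul, Matrix.adjugate_mul, Matrix.transpose_smul,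
          Matrix.transpose_one]
      calc Lᵀ * (ν ^ 2 • (L.adjugateᵀ * U * H.adjugate) * N) * L
          = ν ^ 2 • ((Lᵀ * L.adjugateᵀ) * U * (H.adjugate * (N * L))) := by
            simp only [Matrix.mul_assoc, Matrix.smul_mul, Matrix.mul_smul]
        _ = a ^ 2 • (U * N₀) := by
            rw [hN, e₁, ← Matrix.mul_assoc H.adjugate, Matrix.adjugate_mul, hdetH]
            simp only [Matrix.smul_mul, Matrix.mul_smul, Matrix.one_mul, smul_smul]
            rw [← hν]
            congr 1
            ring
    rw [hS, add_right_inj]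
    refine conj_cancel_of_det_ne_zero ha ?_
    rw [Matrix.mul_smul, Matrix.smul_mul, hUD, Matrix.mul_add, Matrix.add_mul, hW, smul_add,
      ← Matrix.transpose_smul, ← hW]
    simp only [Matrix.transpose_mul, Matrix.transpose_transpose, Matrix.mul_assoc]
  exact ⟨_, main (mul_minorCoeff A B).1 hS₁ hU₁, main (mul_minorCoeff A B).2 hS₂ hU₂⟩

/-- Pairs with the same invariant and associated `λ`-invariants which are congruent modulo `λ ^ 3`
are equivalent. -/
theorem exists_equivalence [IsDomain R] {A B A' B' : Matrix (Fin n) (Fin (n+1)) R}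
    {S₁ S₂ S₁' S₂' : Matrix (Fin (n+1)) (Fin (n+1)) R} {a : R} (μ : Rˣ)
    (ha : (minorCoeff A B).det = a) (ha0 : a ≠ 0) (hμ : (minorCoeff A' B').det = a * μ)
    (hA : A.map (Ideal.Quotient.mk (Ideal.span {a ^ 3})) =
      A'.map (Ideal.Quotient.mk (Ideal.span {a ^ 3})))
    (hB : B.map (Ideal.Quotient.mk (Ideal.span {a ^ 3})) =
      B'.map (Ideal.Quotient.mk (Ideal.span {a ^ 3})))
    (hS₁ : S₁.map (Ideal.Quotient.mk (Ideal.span {a ^ 3})) =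
      S₁'.map (Ideal.Quotient.mk (Ideal.span {a ^ 3})))
    (hS₂ : S₂.map (Ideal.Quotient.mk (Ideal.span {a ^ 3})) =
      S₂'.map (Ideal.Quotient.mk (Ideal.span {a ^ 3})))
    (h₁ : S₁.IsSymm) (h₂ : S₂.IsSymm) (h₁' : S₁'.IsSymm) (h₂' : S₂'.IsSymm)
    (hdet : (Matrix.fromBlocks 0 (pencil A B) (pencil A B)ᵀ (pencil S₁ S₂)).det =
      (Matrix.fromBlocks 0 (pencil A' B') (pencil A' B')ᵀ (pencil S₁' S₂')).det) :
    ∃ (h : Matrix (Fin n) (Fin n) R) (k : Matrix (Fin (n+1)) (Fin (n+1)) R)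
      (u : Matrix (Fin (n+1)) (Fin n) R), h.det * k.det = 1 ∧
      A' = h * A * kᵀ ∧ B' = h * B * kᵀ ∧
      S₁' = k * S₁ * kᵀ + (u * A' + (u * A')ᵀ) ∧ S₂' = k * S₂ * kᵀ + (u * B' + (u * B')ᵀ) := by
  have hdetH : (syzygyCoeff A B).det = a := by rw [det_syzygyCoeff (ha ▸ ha0), ha]
  have ha0' : (minorCoeff A' B').det ≠ 0 := hμ ▸ mul_ne_zero ha0 μ.ne_zero
  have hdetH' : (syzygyCoeff A' B').det = a * μ := by rw [det_syzygyCoeff ha0', hμ]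
  obtain ⟨Z, hZ⟩ : ∃ Z, minorCoeff A' B' = minorCoeff A B + a ^ 3 • Z :=
    exists_eq_add_smul_of_map_mk_eq (by rw [← minorCoeff_map, ← minorCoeff_map, hA, hB])
  obtain ⟨Y, hY⟩ : ∃ Y, syzygyCoeff A' B' = syzygyCoeff A B + a ^ 3 • Y :=
    exists_eq_add_smul_of_map_mk_eq (by rw [← syzygyCoeff_map, ← syzygyCoeff_map, hA, hB])
  obtain ⟨Z₁, hZ₁⟩ := exists_eq_add_smul_of_map_mk_eq hS₁
  obtain ⟨Z₂, hZ₂⟩ := exists_eq_add_smul_of_map_mk_eq hS₂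
  obtain ⟨T, hT, hTdet⟩ := exists_mul_eq_of_eq_add_smul (ha ▸ ha0) (ha ▸ hμ) (ha ▸ hZ)
  obtain ⟨T', hT', hTdet'⟩ := exists_mul_eq_of_eq_add_smul (hdetH ▸ ha0) (hdetH ▸ hdetH')
    (hdetH ▸ hY)
  rw [ha] at hT hTdet
  rw [hdetH] at hT' hTdet'
  set g := 1 + a ^ 2 • T with hg
  set h := 1 + a ^ 2 • T'
  have hunit : IsUnit g.det := hTdet ▸ μ.isUnit
  have hgi : g⁻¹ * g = 1 := Matrix.nonsing_inv_mul g hunit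
  have hgi' : g * g⁻¹ = 1 := Matrix.mul_nonsing_inv g hunit
  have htop {N N' N₀ : Matrix (Fin n) (Fin (n+1)) R}
      (hN : N * minorCoeff A B = syzygyCoeff A B * N₀)
      (hN' : N' * minorCoeff A' B' = syzygyCoeff A' B' * N₀) : N' = h * N * g⁻¹ := by
    have : N' * g = h * N := by
      refine mul_right_cancel_of_det_ne_zero (Q := minorCoeff A B) (ha ▸ ha0) ?_
      rw [Matrix.mul_assoc, hT, hN', ← hT', Matrix.mul_assoc, Matrix.mul_assoc, hN]
    rw [← this, Matrix.mul_assoc, hgi', Matrix.mul_one]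
  have hA' := htop (mul_minorCoeff A B).1 (mul_minorCoeff A' B').1
  have hB' := htop (mul_minorCoeff A B).2 (mul_minorCoeff A' B').2
  obtain ⟨D₁, hD₁⟩ := exists_conj_eq_add_smul hg hgi hZ₁
  obtain ⟨D₂, hD₂⟩ := exists_conj_eq_add_smul hg hgi hZ₂
  have hdetk : h.det * g⁻¹ᵀ.det = 1 := by
    rw [Matrix.det_transpose, hTdet', ← hTdet, ← Matrix.det_mul, hgi', Matrix.det_one]
  have hsymm {S : Matrix (Fin (n+1)) (Fin (n+1)) R} (hS : S.IsSymm) :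
      (g⁻¹ᵀ * S * g⁻¹).IsSymm := by
    simp only [Matrix.IsSymm, Matrix.transpose_mul, Matrix.transpose_transpose, hS.eq,
      Matrix.mul_assoc]
  have hp : pencil A' B' = constMatrix h * pencil A B * constMatrix g⁻¹ := by
    rw [mul_pencil, pencil_mul, ← hA', ← hB']
  have hdet' : (Matrix.fromBlocks 0 (pencil A' B') (pencil A' B')ᵀ
      (pencil (g⁻¹ᵀ * S₁ * g⁻¹) (g⁻¹ᵀ * S₂ * g⁻¹))).det =
      (Matrix.fromBlocks 0 (pencil A' B') (pencil A' B')ᵀ (pencil S₁' S₂')).det := by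
    have hF : Matrix.fromBlocks 0 (pencil A' B') (pencil A' B')ᵀ
        (pencil (g⁻¹ᵀ * S₁ * g⁻¹) (g⁻¹ᵀ * S₂ * g⁻¹)) =
        Matrix.fromBlocks (constMatrix h) 0 0 (constMatrix g⁻¹)ᵀ *
          Matrix.fromBlocks 0 (pencil A B) (pencil A B)ᵀ (pencil S₁ S₂) *
          (Matrix.fromBlocks (constMatrix h) 0 0 (constMatrix g⁻¹)ᵀ)ᵀ := by
      rw [hp, ← pencil_mul, ← mul_pencil, Matrix.fromBlocks_transpose, Matrix.fromBlocks_multiply,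
        Matrix.fromBlocks_multiply]
      simp [Matrix.mul_assoc]
      rfl
    have hG : (Matrix.fromBlocks (constMatrix h) 0 0 (constMatrix g⁻¹)ᵀ).det = 1 := by
      rw [Matrix.det_fromBlocks_zero₂₁, Matrix.det_transpose, det_constMatrix, det_constMatrix,
        ← map_mul, ← Matrix.det_transpose g⁻¹, hdetk, map_one]
    rw [← hdet, hF, Matrix.det_mul, Matrix.det_mul, Matrix.det_transpose, hG, one_mul, mul_one]
  obtain ⟨u, hu₁, hu₂⟩ := exists_unipotent (ν := ↑μ⁻¹) ha0' (by rw [hμ]; simp) hD₁ hD₂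
    (isSymm_of_eq_add_smul (pow_ne_zero 2 ha0) (hsymm h₁) h₁' hD₁)
    (isSymm_of_eq_add_smul (pow_ne_zero 2 ha0) (hsymm h₂) h₂' hD₂) ha0 hdet'
  exact ⟨h, g⁻¹ᵀ, u, hdetk, by rw [Matrix.transpose_transpose, ← hA'],
    by rw [Matrix.transpose_transpose, ← hB'], by rwa [Matrix.transpose_transpose],
    by rwa [Matrix.transpose_transpose]⟩

end Reduction

section Assembly

variable {R : Type*} [CommRing R] {n : ℕ}

/-- Splitting of the indices into the first `n` and the last `n+1`. -/
def blockEquiv (n : ℕ) : Fin n ⊕ Fin (n+1) ≃ Fin (2*n+1) :=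
  finSumFinEquiv.trans (finCongr (by omega))

theorem val_rowIdx_lt (i : Fin n) : (rowIdx n i : ℕ) < n := i.2

theorem le_val_colIdx (j : Fin (n+1)) : n ≤ (colIdx n j : ℕ) := Nat.le_add_right n j

/-- The top-right `n × (n+1)` block. -/
def topRight (A : Matrix (Fin (2*n+1)) (Fin (2*n+1)) R) : Matrix (Fin n) (Fin (n+1)) R :=
  A.submatrix (rowIdx n) (colIdx n)

/-- The bottom-right `(n+1) × (n+1)` block. -/
def bottomRight (A : Matrix (Fin (2*n+1)) (Fin (2*n+1)) R) : Matrix (Fin (n+1)) (Fin (n+1)) R :=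
  A.submatrix (colIdx n) (colIdx n)

theorem submatrix_blockEquiv {A : Matrix (Fin (2*n+1)) (Fin (2*n+1)) R} (hA : A.IsSymm)
    (h0 : ∀ i j : Fin (2*n+1), (i : ℕ) < n → (j : ℕ) < n → A i j = 0) :
    A.submatrix (blockEquiv n) (blockEquiv n) =
      Matrix.fromBlocks 0 (topRight A) (topRight A)ᵀ (bottomRight A) := by
  ext (i | i) (j | j)
  · exact h0 _ _ (val_rowIdx_lt i) (val_rowIdx_lt j)
  · rfl
  · exact hA.apply _ _
  · rfl

theorem det_fromBlocks_of_W0mem {w : MPair n R} (hw : W0mem n w) :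
    (Matrix.fromBlocks 0 (pencil (topRight w.1) (topRight w.2))
      (pencil (topRight w.1) (topRight w.2))ᵀ (pencil (bottomRight w.1) (bottomRight w.2))).det =
      (-1) ^ n * invForm n w := by
  have hF : Matrix.fromBlocks 0 (pencil (topRight w.1) (topRight w.2))
      (pencil (topRight w.1) (topRight w.2))ᵀ (pencil (bottomRight w.1) (bottomRight w.2)) =
      (pencil w.1 w.2).submatrix (blockEquiv n) (blockEquiv n) := by
    have h₁ := submatrix_blockEquiv hw.1.1 fun i j hi hj => (hw.2 i j hi hj).1
    have h₂ := submatrix_blockEquiv hw.1.2 fun i j hi hj => (hw.2 i j hi hj).2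
    change _ = pencil (w.1.submatrix (blockEquiv n) (blockEquiv n))
      (w.2.submatrix (blockEquiv n) (blockEquiv n))
    rw [h₁, h₂]
    ext1 (i | i) (j | j)
    · simp [pencil]
    · rfl
    · rfl
    · rfl
  rw [hF, Matrix.det_submatrix_equiv_self]
  change _ = (-1) ^ n * ((-1) ^ n * (pencil w.1 w.2).det)
  rw [← mul_assoc, ← mul_pow, neg_one_mul, neg_neg, one_pow, one_mul]

theorem lambdaInv_eq_det (w : MPair n R) :
    lambdaInv n w = (minorCoeff (topRight w.1) (topRight w.2)).det := rfl

/-- The lower block-triangular matrix with the given blocks. -/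
def ofBlocks (h : Matrix (Fin n) (Fin n) R) (x : Matrix (Fin (n+1)) (Fin n) R)
    (k : Matrix (Fin (n+1)) (Fin (n+1)) R) : Matrix (Fin (2*n+1)) (Fin (2*n+1)) R :=
  (Matrix.fromBlocks h 0 x k).submatrix (blockEquiv n).symm (blockEquiv n).symm

theorem GNmem_ofBlocks {h : Matrix (Fin n) (Fin n) R} {k : Matrix (Fin (n+1)) (Fin (n+1)) R}
    (hdet : h.det * k.det = 1) (x : Matrix (Fin (n+1)) (Fin n) R) :
    GNmem n (ofBlocks h x k) := by
  refine ⟨?_, fun i j hi hj => ?_⟩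
  · rw [ofBlocks, Matrix.det_submatrix_equiv_self, Matrix.det_fromBlocks_zero₁₂, hdet]
  · obtain ⟨i | i, rfl⟩ := (blockEquiv n).surjective i
    · obtain ⟨j | j, rfl⟩ := (blockEquiv n).surjective j
      · exact absurd (val_rowIdx_lt j) (not_lt.mpr hj)
      · simp [ofBlocks]
    · exact absurd (le_val_colIdx i) (not_le.mpr hi)

theorem fromBlocks_conj {m k : Type*} [Fintype m] [Fintype k] (h : Matrix m m R) (u : Matrix k m R)
    (g S : Matrix k k R) (A : Matrix m k R) :
    Matrix.fromBlocks h 0 (u * h) g * Matrix.fromBlocks 0 A Aᵀ S *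
        (Matrix.fromBlocks h 0 (u * h) g)ᵀ =
      Matrix.fromBlocks 0 (h * A * gᵀ) (h * A * gᵀ)ᵀ
        (g * S * gᵀ + (u * (h * A * gᵀ) + (u * (h * A * gᵀ))ᵀ)) := by
  rw [Matrix.fromBlocks_transpose, Matrix.fromBlocks_multiply, Matrix.fromBlocks_multiply]
  simp only [Matrix.mul_zero, Matrix.zero_mul, zero_add, add_zero, Matrix.transpose_zero,
    Matrix.transpose_mul, Matrix.transpose_transpose, Matrix.mul_assoc, Matrix.add_mul]
  congr 1
  abel

theorem ofBlocks_conj {M M' : Matrix (Fin (2*n+1)) (Fin (2*n+1)) R}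
    {h : Matrix (Fin n) (Fin n) R} {u : Matrix (Fin (n+1)) (Fin n) R}
    {k : Matrix (Fin (n+1)) (Fin (n+1)) R}
    (hM : M.submatrix (blockEquiv n) (blockEquiv n) =
      Matrix.fromBlocks 0 (topRight M) (topRight M)ᵀ (bottomRight M))
    (hM' : M'.submatrix (blockEquiv n) (blockEquiv n) =
      Matrix.fromBlocks 0 (topRight M') (topRight M')ᵀ (bottomRight M'))
    (ht : topRight M' = h * topRight M * kᵀ)
    (hb : bottomRight M' = k * bottomRight M * kᵀ +
      (u * topRight M' + (u * topRight M')ᵀ)) :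
    ofBlocks h (u * h) k * M * (ofBlocks h (u * h) k)ᵀ = M' := by
  have hprod := fromBlocks_conj h u k (bottomRight M) (topRight M)
  rw [← ht, ← hb, ← hM, ← hM'] at hprod
  have := congrArg (fun N => N.submatrix (blockEquiv n).symm (blockEquiv n).symm) hprod
  simpa [ofBlocks, ← Matrix.submatrix_mul_equiv _ _ _ (blockEquiv n).symm] using this

/-- Pairs in `W_N^0` with the same invariant and associated `λ`-invariants which are congruent
modulo `λ ^ 3` are `G_N`-equivalent. -/
theorem exists_GNmem_actPair_eq [IsDomain R] {w w' : MPair n R} (hw : W0mem n w)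
    (hw' : W0mem n w') (hinv : invForm n w = invForm n w') (h0 : lambdaInv n w ≠ 0) (μ : Rˣ)
    (hμ : lambdaInv n w' = lambdaInv n w * μ)
    (h₁ : w.1.map (Ideal.Quotient.mk (Ideal.span {lambdaInv n w ^ 3})) =
      w'.1.map (Ideal.Quotient.mk (Ideal.span {lambdaInv n w ^ 3})))
    (h₂ : w.2.map (Ideal.Quotient.mk (Ideal.span {lambdaInv n w ^ 3})) =
      w'.2.map (Ideal.Quotient.mk (Ideal.span {lambdaInv n w ^ 3}))) :
    ∃ g, GNmem n g ∧ actPair g w = w' := by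
  have hdetF := det_fromBlocks_of_W0mem hw
  rw [hinv, ← det_fromBlocks_of_W0mem hw'] at hdetF
  have ha := (lambdaInv_eq_det w).symm
  rw [lambdaInv_eq_det w'] at hμ
  generalize lambdaInv n w = a at *
  have htop {M M' : Matrix (Fin (2*n+1)) (Fin (2*n+1)) R} {I : Ideal R}
      (h : M.map (Ideal.Quotient.mk I) = M'.map (Ideal.Quotient.mk I)) :
      (topRight M).map (Ideal.Quotient.mk I) = (topRight M').map (Ideal.Quotient.mk I) :=
    congrArg (fun N => N.submatrix (rowIdx n) (colIdx n)) h
  have hbot {M M' : Matrix (Fin (2*n+1)) (Fin (2*n+1)) R} {I : Ideal R}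
      (h : M.map (Ideal.Quotient.mk I) = M'.map (Ideal.Quotient.mk I)) :
      (bottomRight M).map (Ideal.Quotient.mk I) = (bottomRight M').map (Ideal.Quotient.mk I) :=
    congrArg (fun N => N.submatrix (colIdx n) (colIdx n)) h
  have hsymm {M : Matrix (Fin (2*n+1)) (Fin (2*n+1)) R} (hM : M.IsSymm) :
      (bottomRight M).IsSymm := hM.submatrix _
  obtain ⟨h, k, u, hdet, hA, hB, hS, hT⟩ := exists_equivalence μ ha h0 hμ (htop h₁) (htop h₂)
    (hbot h₁) (hbot h₂) (hsymm hw.1.1) (hsymm hw.1.2) (hsymm hw'.1.1) (hsymm hw'.1.2) hdetF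
  have h₀ := submatrix_blockEquiv hw.1.1 fun i j hi hj => (hw.2 i j hi hj).1
  have h₀' := submatrix_blockEquiv hw'.1.1 fun i j hi hj => (hw'.2 i j hi hj).1
  have k₀ := submatrix_blockEquiv hw.1.2 fun i j hi hj => (hw.2 i j hi hj).2
  have k₀' := submatrix_blockEquiv hw'.1.2 fun i j hi hj => (hw'.2 i j hi hj).2
  exact ⟨ofBlocks h (u * h) k, GNmem_ofBlocks hdet _,
    Prod.ext (ofBlocks_conj h₀ h₀' hA hS) (ofBlocks_conj k₀ k₀' hB hT)⟩

theorem exists_unit_of_pvalEq {p : ℕ} [Fact p.Prime] {x : ℤ_[p]} {e : ℕ} (h : pvalEq x e) :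
    ∃ c : ℤ_[p]ˣ, x = (p : ℤ_[p]) ^ e * c := by
  obtain ⟨⟨c, rfl⟩, hnot⟩ := h
  have hc : IsUnit c := by
    by_contra hc
    rw [PadicInt.not_isUnit_iff, PadicInt.norm_lt_one_iff_dvd] at hc
    exact hnot (pow_succ (p : ℤ_[p]) e ▸ mul_dvd_mul_left _ hc)
  exact ⟨hc.unit, rfl⟩

/-- Reduction modulo `p ^ (3 e)` separates the orbits. -/
theorem injective_reduction_out (n p : ℕ) [Fact p.Prime] (f : MvPolynomial (Fin 2) ℤ_[p])
    (e : ℕ) :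
    Function.Injective fun q : GNorbits n p f e =>
      ((q.out : MPair n ℤ_[p]).1.map (PadicInt.toZModPow (3*e)),
        (q.out : MPair n ℤ_[p]).2.map (PadicInt.toZModPow (3*e))) := by
  intro q q' hqq'
  rw [← Quot.out_eq q, ← Quot.out_eq q']
  obtain ⟨⟨w, hw, hf, he⟩, hwq⟩ : ∃ w, w = q.out := ⟨_, rfl⟩
  obtain ⟨⟨w', hw', hf', he'⟩, hwq'⟩ : ∃ w, w = q'.out := ⟨_, rfl⟩
  simp only [← hwq, ← hwq', Prod.mk.injEq] at hqq' ⊢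
  obtain ⟨c, hc⟩ := exists_unit_of_pvalEq he
  obtain ⟨c', hc'⟩ := exists_unit_of_pvalEq he'
  have hp : (p : ℤ_[p]) ≠ 0 := PadicInt.prime_p.ne_zero
  have hI : Ideal.span {lambdaInv n w ^ 3} = RingHom.ker (PadicInt.toZModPow (p := p) (3*e)) := by
    rw [PadicInt.ker_toZModPow, hc, mul_pow, ← pow_mul, mul_comm e 3, ← Units.val_pow_eq_pow_val,
      Ideal.span_singleton_mul_right_unit (Units.isUnit _)]
  have hcongr {M M' : Matrix (Fin (2*n+1)) (Fin (2*n+1)) ℤ_[p]}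
      (h : M.map (PadicInt.toZModPow (3*e)) = M'.map (PadicInt.toZModPow (3*e))) :
      M.map (Ideal.Quotient.mk (Ideal.span {lambdaInv n w ^ 3})) =
        M'.map (Ideal.Quotient.mk (Ideal.span {lambdaInv n w ^ 3})) := by
    ext i j
    rw [Matrix.map_apply, Matrix.map_apply, Ideal.Quotient.eq, hI, RingHom.sub_mem_ker_iff]
    exact congrFun (congrFun h i) j
  refine Quot.sound (exists_GNmem_actPair_eq hw hw' (hf.trans hf'.symm) ?_ (c⁻¹ * c') ?_
    (hcongr hqq'.1) (hcongr hqq'.2))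
  · rw [hc]
    exact mul_ne_zero (pow_ne_zero e hp) c.ne_zero
  · rw [hc, hc', Units.val_mul, mul_assoc, Units.mul_inv_cancel_left]

end Assembly

/-- **Bounding the number of `G_N(ℤ_p)`-orbits with prescribed `λ`-valuation
(Lemma 2.10).**  There are integers `γ₁, γ₂ ≥ 1`, depending only on `N`, such that for
every prime `p`, every binary `N`-ic form `f` over `ℤ_p` with nonzero discriminant, and
every `e ≥ 0`, the set of `G_N(ℤ_p)`-orbits on
`{(A,B) ∈ W_N^0(ℤ_p) : inv(A,B) = f, ν_p(λ(A,B)) = e}` is finite of cardinality at most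
`p^{e γ₁ n^{γ₂}}`. -/
theorem GN_orbit_count_bound (n : ℕ) (hn : 1 ≤ n) :
    ∃ γ₁ γ₂ : ℕ, 1 ≤ γ₁ ∧ 1 ≤ γ₂ ∧
      ∀ (p : ℕ) (hp : Fact p.Prime) (f : MvPolynomial (Fin 2) ℤ_[p]),
        f.IsHomogeneous (2*n+1) →
        Squarefree (MvPolynomial.map (PadicInt.Coe.ringHom (p := p)) f) →
        ∀ e : ℕ,
          Finite (GNorbits n p f e) ∧
          Nat.card (GNorbits n p f e) ≤ p ^ (e * γ₁ * n ^ γ₂) := by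
  refine ⟨6 * (2*n+1) ^ 2, 1, Nat.mul_pos (by norm_num) (by positivity), le_rfl,
    fun p hp f _ _ e => ?_⟩
  have hinj := injective_reduction_out n p f e
  have : NeZero (p ^ (3*e)) := ⟨pow_ne_zero _ hp.out.ne_zero⟩
  have : Finite (Matrix (Fin (2*n+1)) (Fin (2*n+1)) (ZMod (p ^ (3*e)))) :=
    inferInstanceAs (Finite (Fin (2*n+1) → Fin (2*n+1) → ZMod (p ^ (3*e))))
  have hcard : Nat.card (Matrix (Fin (2*n+1)) (Fin (2*n+1)) (ZMod (p ^ (3*e)))) =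
      p ^ (3 * e * (2*n+1) ^ 2) := by
    change Nat.card (Fin (2*n+1) → Fin (2*n+1) → ZMod (p ^ (3*e))) = _
    rw [Nat.card_fun, Nat.card_fun, Nat.card_zmod, Nat.card_fin, ← pow_mul, ← pow_mul,
      mul_assoc, ← sq, ← mul_assoc]
  refine ⟨Finite.of_injective _ hinj, (Nat.card_le_card_of_injective _ hinj).trans ?_⟩
  rw [Nat.card_prod, hcard, ← pow_add]
  refine Nat.pow_le_pow_right hp.out.pos ?_
  calc 3 * e * (2*n+1) ^ 2 + 3 * e * (2*n+1) ^ 2 = e * (6 * (2*n+1) ^ 2) * 1 := by ring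
    _ ≤ e * (6 * (2*n+1) ^ 2) * n ^ 1 := Nat.mul_le_mul_left _ (by rwa [pow_one])
end

section
/- Let p be a prime and k ≥ 1 an integer. Then the number of 2×2 matrices M over ℤ/p^kℤ whose determinant equals p^{k−1}·u for some unit u ∈ (ℤ/p^kℤ)^× (equivalently, det M ≠ 0 and p^{k−1} divides det M in ℤ/p^kℤ) is p^{2k−1}(p² − 1)(p^k − 1). -/
open Finset

theorem AddMonoidHom.card_ker_mul_card_range {G H : Type*} [AddGroup G] [AddGroup H]
    (f : G →+ H) : Nat.card f.ker * Nat.card f.range = Nat.card G := by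
  rw [← AddSubgroup.index_ker, AddSubgroup.card_mul_index]

section Annihilators

variable {R : Type*} [CommRing R] [Fintype R] [DecidableEq R]

/-- The additive map `(c, d) ↦ a * d - b * c`, the determinant as a function of the second row. -/
def detSecondRow (a b : R) : R × R →+ R where
  toFun v := a * v.2 - b * v.1
  map_zero' := by simp
  map_add' x y := by simp only [Prod.fst_add, Prod.snd_add]; ring

theorem card_detSecondRow_ker [IsPrincipalIdealRing R] (a b : R) :
    #{v : R × R | a * v.2 - b * v.1 = 0} =
      Fintype.card R * #{r : R | r * a = 0 ∧ r * b = 0} := by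
  obtain ⟨g, hg⟩ := (IsPrincipalIdealRing.principal (Ideal.span {a, b})).principal
  change Ideal.span {a, b} = Ideal.span {g} at hg
  obtain ⟨a', ha⟩ : g ∣ a := by
    rw [← Ideal.mem_span_singleton, ← hg]; exact Ideal.subset_span (by simp)
  obtain ⟨b', hb⟩ : g ∣ b := by
    rw [← Ideal.mem_span_singleton, ← hg]; exact Ideal.subset_span (by simp)
  obtain ⟨x, y, hxy⟩ : ∃ x y, x * a + y * b = g := by
    rw [← Ideal.mem_span_pair, hg]; exact Ideal.mem_span_singleton_self g
  have hrange : (detSecondRow a b).range = (AddMonoidHom.mulLeft g).range := by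
    ext z
    simp only [AddMonoidHom.mem_range, detSecondRow, AddMonoidHom.coe_mk, ZeroHom.coe_mk,
      AddMonoidHom.coe_mulLeft, Prod.exists]
    constructor
    · rintro ⟨c, d, rfl⟩
      exact ⟨a' * d - b' * c, by rw [ha, hb]; ring⟩
    · rintro ⟨t, rfl⟩
      exact ⟨-(y * t), x * t, by rw [← hxy]; ring⟩
  have h1 := (detSecondRow a b).card_ker_mul_card_range
  have h2 := (AddMonoidHom.mulLeft g).card_ker_mul_card_range
  have e1 : Nat.card (detSecondRow a b).ker = #{v : R × R | a * v.2 - b * v.1 = 0} := by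
    rw [← Fintype.card_subtype, ← Nat.card_eq_fintype_card]; rfl
  have e2 : Nat.card (AddMonoidHom.mulLeft g).ker = #{r : R | r * a = 0 ∧ r * b = 0} := by
    rw [← Fintype.card_subtype, ← Nat.card_eq_fintype_card]
    refine Nat.card_congr (Equiv.subtypeEquivRight fun r => ?_)
    rw [AddMonoidHom.mem_ker, AddMonoidHom.coe_mulLeft]
    constructor
    · intro h
      constructor
      · rw [ha]; linear_combination a' * h
      · rw [hb]; linear_combination b' * h
    · rintro ⟨h, h'⟩
      rw [← hxy]; linear_combination x * h + y * h'
  rw [hrange, e1, Nat.card_prod, ← h2, e2, mul_assoc] at h1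
  rw [← Nat.card_eq_fintype_card, ← h2, e2]
  have hpos : 0 < Nat.card (AddMonoidHom.mulLeft g).range := Nat.card_pos
  apply Nat.eq_of_mul_eq_mul_right hpos
  rw [h1]; ring

theorem sum_card_annihilator_pair :
    ∑ w : R × R, #{r : R | r * w.1 = 0 ∧ r * w.2 = 0} = ∑ r : R, #{s : R | r * s = 0} ^ 2 := by
  simp only [card_filter]
  rw [sum_comm]
  refine sum_congr rfl fun r _ => ?_
  rw [← card_filter, ← card_filter, sq, ← card_product, ← filter_product, univ_product_univ]

theorem card_detSecondRow_mem (a b : R) (T : Finset R)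
    (hT : ∀ t ∈ T, ∃ x y, x * a + y * b = t) :
    #{v : R × R | a * v.2 - b * v.1 ∈ T} = #T * #{v : R × R | a * v.2 - b * v.1 = 0} := by
  rw [card_eq_sum_card_fiberwise (s := {v : R × R | a * v.2 - b * v.1 ∈ T}) (t := T)
    (f := detSecondRow a b) (fun v hv => by simpa [detSecondRow] using hv), ← smul_eq_mul,
    ← sum_const]
  refine sum_congr rfl fun t ht => ?_
  obtain ⟨x, y, hxy⟩ := hT t ht
  have := AddMonoidHom.card_fiber_eq_of_mem_range (detSecondRow a b)
    (x := t) (y := 0) ⟨(-y, x), by simp [detSecondRow, ← hxy]; ring⟩ ⟨0, map_zero _⟩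
  rw [filter_filter]
  refine Eq.trans (congrArg card (filter_congr fun v _ => ?_)) this
  exact ⟨fun h => h.2, fun h => ⟨(show a * v.2 - b * v.1 = t from h) ▸ ht, h⟩⟩

/-- If `T` lies in every nonzero ideal, the matrices whose determinant lies in `T` are counted by
annihilators. -/
theorem card_det_mem [IsPrincipalIdealRing R] (T : Finset R) (h0 : 0 ∉ T)
    (hT : ∀ x ≠ 0, ∀ t ∈ T, x ∣ t) :
    #{M : Matrix (Fin 2) (Fin 2) R | M.det ∈ T} + #T * Fintype.card R ^ 2 =
      #T * Fintype.card R * ∑ r : R, #{s : R | r * s = 0} ^ 2 := by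
  let e : Matrix (Fin 2) (Fin 2) R ≃ (R × R) × (R × R) :=
    { toFun := fun M => ((M 0 0, M 0 1), (M 1 0, M 1 1))
      invFun := fun v => !![v.1.1, v.1.2; v.2.1, v.2.2]
      left_inv := fun M => (Matrix.eta_fin_two M).symm
      right_inv := fun v => rfl }
  have hcount : #{M : Matrix (Fin 2) (Fin 2) R | M.det ∈ T} =
      ∑ w : R × R, #{v : R × R | w.1 * v.2 - w.2 * v.1 ∈ T} := by
    have := card_equiv (s := {M : Matrix (Fin 2) (Fin 2) R | M.det ∈ T})
      (t := {v : (R × R) × (R × R) | v.1.1 * v.2.2 - v.1.2 * v.2.1 ∈ T}) e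
      (fun M => by simp only [mem_filter, mem_univ, true_and, Matrix.det_fin_two]; rfl)
    rw [this]
    simp only [card_filter]
    exact Fintype.sum_prod_type _
  rw [hcount, ← sum_card_annihilator_pair, mul_sum, ← add_sum_erase _ _ (mem_univ (0 : R × R)),
    ← add_sum_erase univ (fun w : R × R => #T * Fintype.card R *
      #{r : R | r * w.1 = 0 ∧ r * w.2 = 0}) (mem_univ (0 : R × R))]
  have hz : #{v : R × R | (0 : R × R).1 * v.2 - (0 : R × R).2 * v.1 ∈ T} = 0 := by simp [h0]
  have hz' : #{r : R | r * (0 : R × R).1 = 0 ∧ r * (0 : R × R).2 = 0} = Fintype.card R := by simp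
  rw [hz, hz', zero_add, add_comm]
  congr 1
  · ring
  · refine sum_congr rfl fun w hw => ?_
    rw [card_detSecondRow_mem, card_detSecondRow_ker, mul_assoc]
    intro t ht
    have hw : w ≠ 0 := by simpa using hw
    by_cases h : w.1 = 0
    · have h' : w.2 ≠ 0 := fun h' => hw (Prod.ext h h')
      obtain ⟨y, rfl⟩ := hT _ h' t ht
      exact ⟨0, y, by ring⟩
    · obtain ⟨y, rfl⟩ := hT _ h t ht
      exact ⟨y, 0, by ring⟩

end Annihilators

namespace ZMod

theorem card_annihilator (n : ℕ) [NeZero n] (m : ℕ) :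
    #{s : ZMod n | (m : ZMod n) * s = 0} = n.gcd m := by
  have h := (AddMonoidHom.mulLeft (m : ZMod n)).card_ker_mul_card_range
  have e1 : Nat.card (AddMonoidHom.mulLeft (m : ZMod n)).ker =
      #{s : ZMod n | (m : ZMod n) * s = 0} := by
    rw [← Fintype.card_subtype, ← Nat.card_eq_fintype_card]; rfl
  have e2 : (AddMonoidHom.mulLeft (m : ZMod n)).range = AddSubgroup.zmultiples (m : ZMod n) := by
    ext z
    rw [AddMonoidHom.mem_range, AddSubgroup.mem_zmultiples_iff]
    constructor
    · rintro ⟨t, rfl⟩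
      obtain ⟨t, rfl⟩ := ZMod.intCast_surjective t
      exact ⟨t, by simp [mul_comm]⟩
    · rintro ⟨t, rfl⟩
      exact ⟨t, by simp [mul_comm]⟩
  have hn := NeZero.ne n
  have hd : n.gcd m ∣ n := Nat.gcd_dvd_left n m
  rw [e1, e2, Nat.card_zmultiples, ZMod.addOrderOf_coe m hn, Nat.card_zmod] at h
  have hpos : 0 < n / n.gcd m := Nat.div_pos (Nat.le_of_dvd (NeZero.pos n) hd)
    (Nat.gcd_pos_of_pos_left _ (NeZero.pos n))
  apply Nat.eq_of_mul_eq_mul_right hpos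
  rw [h, Nat.mul_div_cancel' hd]

theorem sum_card_annihilator_sq (n : ℕ) [NeZero n] :
    ∑ r : ZMod n, #{s : ZMod n | r * s = 0} ^ 2 = ∑ d ∈ n.divisors, (n / d).totient * d ^ 2 := by
  have h1 : ∑ r : ZMod n, #{s : ZMod n | r * s = 0} ^ 2 = ∑ m ∈ range n, n.gcd m ^ 2 := by
    refine sum_bij (fun r _ => r.val) (fun r _ => by simpa using r.val_lt)
      (fun a _ b _ h => ZMod.val_injective n h)
      (fun m hm => ⟨m, mem_univ _, ZMod.val_cast_of_lt (by simpa using hm)⟩) fun r _ => ?_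
    rw [← card_annihilator, ZMod.natCast_zmod_val]
  rw [h1, ← sum_fiberwise_of_maps_to (t := n.divisors) (g := fun m => n.gcd m)
    (fun m _ => by simp [Nat.gcd_dvd_left, NeZero.ne n])]
  refine sum_congr rfl fun d hd => ?_
  rw [Nat.totient_div_of_dvd (Nat.dvd_of_mem_divisors hd), ← smul_eq_mul, ← sum_const]
  exact sum_congr rfl fun m hm => by rw [(mem_filter.mp hm).2]

variable {p k : ℕ}

theorem sum_card_annihilator_sq_prime_pow (hp : p.Prime) [NeZero (p ^ k)] (hk : 1 ≤ k) :
    ∑ r : ZMod (p ^ k), #{s : ZMod (p ^ k) | r * s = 0} ^ 2 =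
      p ^ (k - 1) * (p ^ k - 1) + p ^ (2 * k) := by
  rw [sum_card_annihilator_sq, Nat.sum_divisors_prime_pow hp, sum_range_succ,
    Nat.div_self (NeZero.pos _), Nat.totient_one, one_mul, ← pow_mul, mul_comm k 2]
  congr 1
  have hterm : ∀ i ∈ range k, (p ^ k / p ^ i).totient * (p ^ i) ^ 2 =
      p ^ (k - 1) * (p - 1) * p ^ i := fun i hi => by
    have hi := mem_range.mp hi
    rw [Nat.pow_div hi.le hp.pos, Nat.totient_prime_pow hp (Nat.sub_pos_of_lt hi),
      show k - 1 = (k - i - 1) + i by omega]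
    ring
  rw [sum_congr rfl hterm, ← mul_sum, mul_assoc, mul_comm (p - 1),
    geom_sum_mul_of_one_le hp.one_le]

theorem pow_prime_eq_zero_iff (hp : p.Prime) (j : ℕ) : (p : ZMod (p ^ k)) ^ j = 0 ↔ k ≤ j := by
  rw [← Nat.cast_pow, ZMod.natCast_eq_zero_iff, Nat.pow_dvd_pow_iff_le_right hp.one_lt]

theorem exists_eq_prime_pow_mul_unit (hp : p.Prime) {x : ZMod (p ^ k)} (hx : x ≠ 0) :
    ∃ j < k, ∃ u : (ZMod (p ^ k))ˣ, x = (p : ZMod (p ^ k)) ^ j * u := by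
  have : NeZero (p ^ k) := ⟨(pow_pos hp.pos k).ne'⟩
  have hv : x.val ≠ 0 := by rwa [Ne, ZMod.val_eq_zero]
  obtain ⟨j, m, hm, hj⟩ := Nat.exists_eq_pow_mul_and_not_dvd hv p hp.ne_one
  have hx' : x = (p : ZMod (p ^ k)) ^ j * m := by
    rw [← ZMod.natCast_zmod_val x, hj]; push_cast; rfl
  refine ⟨j, ?_, ZMod.unitOfCoprime m ?_, by rw [ZMod.coe_unitOfCoprime, hx']⟩
  · by_contra! h
    exact hx (by rw [hx', (pow_prime_eq_zero_iff hp j).mpr h, zero_mul])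
  · exact ((hp.coprime_iff_not_dvd.mpr hm).symm).pow_right k

theorem dvd_prime_pow_pred_mul (hp : p.Prime) {x : ZMod (p ^ k)} (hx : x ≠ 0)
    (u : ZMod (p ^ k)) : x ∣ (p : ZMod (p ^ k)) ^ (k - 1) * u := by
  obtain ⟨j, hj, v, rfl⟩ := exists_eq_prime_pow_mul_unit hp hx
  rw [Units.mul_right_dvd]
  exact (pow_dvd_pow _ (by omega)).mul_right _

theorem exists_eq_prime_pow_pred_mul_unit_iff (hp : p.Prime) (hk : 1 ≤ k) (x : ZMod (p ^ k)) :
    (∃ u : (ZMod (p ^ k))ˣ, x = (p : ZMod (p ^ k)) ^ (k - 1) * u) ↔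
      x ≠ 0 ∧ (p : ZMod (p ^ k)) * x = 0 := by
  constructor
  · rintro ⟨u, rfl⟩
    rw [Ne, Units.mul_left_eq_zero, ← mul_assoc, Units.mul_left_eq_zero, ← pow_succ',
      pow_prime_eq_zero_iff hp, pow_prime_eq_zero_iff hp]
    omega
  · rintro ⟨hx, hpx⟩
    obtain ⟨j, hj, u, rfl⟩ := exists_eq_prime_pow_mul_unit hp hx
    rw [← mul_assoc, Units.mul_left_eq_zero, ← pow_succ', pow_prime_eq_zero_iff hp] at hpx
    exact ⟨u, by rw [show k - 1 = j by omega]⟩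

end ZMod

/-- **Counting `2 × 2` matrices over `ℤ/p^kℤ` of determinant valuation `k - 1`.**
Let `p` be a prime and `k ≥ 1`.  The number of `2 × 2` matrices `M` over `ℤ/p^kℤ` whose
determinant equals `p^{k-1} · u` for some unit `u` of `ℤ/p^kℤ` is
`p^{2k-1} (p² - 1)(p^k - 1)`. -/
theorem count_matrices_det_valuation (p k : ℕ) (hp : p.Prime) (hk : 1 ≤ k) :
    Nat.card {M : Matrix (Fin 2) (Fin 2) (ZMod (p ^ k)) //
        ∃ u : (ZMod (p ^ k))ˣ, M.det = (p : ZMod (p ^ k)) ^ (k - 1) * (u : ZMod (p ^ k))} =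
      p ^ (2 * k - 1) * (p ^ 2 - 1) * (p ^ k - 1) := by
  have : NeZero (p ^ k) := ⟨(pow_pos hp.pos k).ne'⟩
  have : IsPrincipalIdealRing (ZMod (p ^ k)) :=
    .of_surjective (Int.castRingHom _) (ZMod.ringHom_surjective _)
  let T : Finset (ZMod (p ^ k)) := {x | (p : ZMod (p ^ k)) * x = 0}
  have hT : #(T.erase 0) = p - 1 := by
    rw [card_erase_of_mem (by simp [T]), ZMod.card_annihilator,
      Nat.gcd_eq_right (dvd_pow_self p (by omega))]
  have key := card_det_mem (T.erase 0) (by simp) fun x hx t ht => by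
    obtain ⟨u, rfl⟩ := (ZMod.exists_eq_prime_pow_pred_mul_unit_iff hp hk t).mpr
      (by simpa [T] using ht)
    exact ZMod.dvd_prime_pow_pred_mul hp hx u
  rw [hT, ZMod.card, ZMod.sum_card_annihilator_sq_prime_pow hp hk] at key
  have hcard : Nat.card {M : Matrix (Fin 2) (Fin 2) (ZMod (p ^ k)) //
        ∃ u : (ZMod (p ^ k))ˣ, M.det = (p : ZMod (p ^ k)) ^ (k - 1) * (u : ZMod (p ^ k))} =
      #{M : Matrix (Fin 2) (Fin 2) (ZMod (p ^ k)) | M.det ∈ T.erase 0} := by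
    rw [← Fintype.card_subtype, ← Nat.card_eq_fintype_card]
    refine Nat.card_congr (Equiv.subtypeEquivRight fun M => ?_)
    rw [ZMod.exists_eq_prime_pow_pred_mul_unit_iff hp hk]
    simp [T]
  rw [hcard]
  apply Nat.add_right_cancel (m := (p - 1) * (p ^ k) ^ 2)
  rw [key]
  obtain ⟨k, rfl⟩ := Nat.exists_eq_add_of_le' hk
  have hp1 : 1 ≤ p := hp.one_le
  have hp2 : 1 ≤ p ^ 2 := Nat.one_le_pow _ _ hp.pos
  have hpk : 1 ≤ p ^ (k + 1) := Nat.one_le_pow _ _ hp.pos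
  rw [show 2 * (k + 1) - 1 = 2 * k + 1 by omega, Nat.add_sub_cancel]
  zify [hp1, hp2, hpk]
  ring
end
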